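/- Let G = (V, E) be a finite DAG, let Y ∈ V, let B be a proper ancestor of Y (B ∈ An(Y), B ≠ Y) with B ∉ L∞(Pa(Y)), and let Z be the unique node of L∞(Pa(Y)) reachable from B by a non-trivial path none of whose nodes other than Z lies in L∞(Pa(Y)). Then every path from B to Y contains Z. -/

import Mathlib

open scoped Classical

/-! ## Directed graphs, paths, ancestors -/

/-- A directed graph (given by its edge relation) is acyclic if no node is
reachable from itself by a non-trivial directed walk. -/
def Acyclic {V : Type} (E : V → V → Prop) : Prop :=
  ∀ v : V, ¬ Relation.TransGen E v v

/-- `IsPath E a b p` : the list `p` is a directed path from `a` to `b` in the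
graph with edge relation `E` (a path is a nonempty list of nodes in which each
node has an edge to the next; a single-node path is trivial). -/
def IsPath {V : Type} (E : V → V → Prop) (a b : V) (p : List V) : Prop :=
  p.Chain' E ∧ p.head? = some a ∧ p.getLast? = some b

/-- Descendants of `v` (every node is a descendant of itself). -/
def De {V : Type} (E : V → V → Prop) (v : V) : Set V :=
  {u | Relation.ReflTransGen E v u}

/-- Ancestors of `v` (every node is an ancestor of itself). -/
def An {V : Type} (E : V → V → Prop) (v : V) : Set V :=
  {u | Relation.ReflTransGen E u v}

/-- Parents of `v`. -/
def Pa {V : Type} (E : V → V → Prop) (v : V) : Set V :=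
  {p | E p v}

/-! ## Strict common ancestors, LSCAs, and the LSCA closure -/

/-- `v` is a strict common ancestor of `x` and `y` : there is a path from `v`
to `x` not containing `y`, and a path from `v` to `y` not containing `x`. -/
def SCA {V : Type} (E : V → V → Prop) (x y : V) : Set V :=
  {v | (∃ p, IsPath E v x p ∧ y ∉ p) ∧ (∃ p, IsPath E v y p ∧ x ∉ p)}

/-- `v` is a lowest strict common ancestor of `x` and `y` : it is a strict
common ancestor, and no strict common ancestor of `x,y` other than `v` is a
descendant of `v`. -/
def LSCApair {V : Type} (E : V → V → Prop) (x y : V) : Set V :=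
  {v | v ∈ SCA E x y ∧ ∀ w ∈ SCA E x y, w ≠ v → w ∉ De E v}

/-- The lowest strict common ancestors of a set `U` : nodes outside `U` that
are a lowest strict common ancestor of some pair of nodes of `U`. -/
def LSCAset {V : Type} (E : V → V → Prop) (U : Set V) : Set V :=
  {v | v ∉ U ∧ ∃ u ∈ U, ∃ u' ∈ U, v ∈ LSCApair E u u'}

/-- The `i`-th order LSCA set of `U`. -/
def lscaIter {V : Type} (E : V → V → Prop) (U : Set V) : ℕ → Set V
  | 0 => U
  | k + 1 => LSCAset E (lscaIter E U k) ∪ lscaIter E U k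

/-- The LSCA closure `L∞(U)` of `U`.  (The sets `lscaIter E U i` are increasing
in `i`, so on a finite node type this union equals `lscaIter E U k` for the
least `k` with `lscaIter E U k = lscaIter E U (k+1)`.) -/
def lscaClosure {V : Type} (E : V → V → Prop) (U : Set V) : Set V :=
  ⋃ k : ℕ, lscaIter E U k

/-! ## Λ-structures -/

/-- `(v, pa, pb)` is a Λ-structure over `(a, b)` : `pa` is a path from `v` to
`a`, `pb` is a path from `v` to `b`, and the two paths intersect only at `v`
(trivial paths are allowed). -/
def IsLambdaStruct {V : Type} (E : V → V → Prop) (v a b : V) (pa pb : List V) : Prop :=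
  IsPath E v a pa ∧ IsPath E v b pb ∧ ∀ w ∈ pa, w ∈ pb → w = v

/-- `Λ(U, W)` : the set of nodes forming a Λ-structure over `(U, W)`. -/
def LambdaSet {V : Type} (E : V → V → Prop) (U W : Set V) : Set V :=
  {v | ∃ u ∈ U, ∃ w ∈ W, ∃ pa pb : List V, IsLambdaStruct E v u w pa pb}

/-! ## Structural causal models -/

/-- A structural causal model over the graph with node type `V` and edge
relation `E` : each node `v` has a nonempty finite range `R v`, a nonempty
finite noise range `N v`, and a structural assignment `f v` computing the value
of `v` from the values of its parents and its noise value. -/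
structure SCM (V : Type) (E : V → V → Prop) where
  R : V → Type
  rFin : ∀ v, Finite (R v)
  rNe : ∀ v, Nonempty (R v)
  N : V → Type
  nFin : ∀ v, Finite (N v)
  nNe : ∀ v, Nonempty (N v)
  f : ∀ v : V, (∀ p : {p // E p v}, R p.1) → N v → R v

/-- Fuel-bounded approximation to the unrolled assignment. -/
noncomputable def approx {V : Type} {E : V → V → Prop} (scm : SCM V E)
    (n : ∀ v, scm.N v) : ℕ → ∀ v, scm.R v
  | 0 => fun v => (scm.rNe v).some
  | k + 1 => fun v => scm.f v (fun p => approx scm n k p.1) (n v)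

/-- The unrolled assignment `f̄_v(n)` of an SCM over an acyclic graph: the value
of `v` obtained by recursively composing the structural assignments of the
ancestors of `v`, evaluated at the unit `n`.  (On an acyclic graph every
directed path has fewer than `card V + 1` nodes, so this fuel value computes
the exact fixed point of the unrolling recursion
`f̄_v(n) = f_v((f̄_p(n))_{p ∈ Pa(v)}, n_v)`.) -/
noncomputable def unroll {V : Type} [Fintype V] {E : V → V → Prop} (scm : SCM V E)
    (n : ∀ v, scm.N v) (v : V) : scm.R v :=
  approx scm n (Fintype.card V + 1) v

/-- The atomic intervention `do(X = x)` : replace the structural assignment of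
`X` by the constant function with value `x`. -/
noncomputable def SCM.intervene {V : Type} {E : V → V → Prop} (scm : SCM V E)
    (X : V) (x : scm.R X) : SCM V E where
  R := scm.R
  rFin := scm.rFin
  rNe := scm.rNe
  N := scm.N
  nFin := scm.nFin
  nNe := scm.nNe
  f := fun v => if h : v = X then fun _ _ => h.symm ▸ x else scm.f v

/-- Fuel-bounded approximation to the blocked unrolled assignment. -/
noncomputable def blockApprox {V : Type} [Fintype V] {E : V → V → Prop} (scm : SCM V E)
    (B : V) (b : scm.R B) (n : ∀ v, scm.N v) : ℕ → ∀ v, scm.R v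
  | 0 => fun v =>
      if h : v = B then h.symm ▸ b
      else if Relation.ReflTransGen E B v then (scm.rNe v).some
      else unroll scm n v
  | k + 1 => fun v =>
      if h : v = B then h.symm ▸ b
      else if Relation.ReflTransGen E B v then
        scm.f v (fun p => blockApprox scm B b n k p.1) (n v)
      else unroll scm n v

/-- The blocked unrolled assignment `f̄_v[B](b, n)` : equal to `b` at `v = B`,
to the plain unrolled assignment `f̄_v(n)` if `v` is not a descendant of `B`,
and otherwise obtained by the unrolling recursion
`f̄_v[B](b,n) = f_v((f̄_p[B](b,n))_{p ∈ Pa(v)}, n_v)`. -/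
noncomputable def blockUnroll {V : Type} [Fintype V] {E : V → V → Prop} (scm : SCM V E)
    (B : V) (b : scm.R B) (n : ∀ v, scm.N v) (v : V) : scm.R v :=
  blockApprox scm B b n (Fintype.card V + 1) v

/-- The edge relation of the graph obtained after a conditional intervention on
`X` with conditioning set `A` : the parent set of `X` becomes `A`, and all
other edges are unchanged. -/
def condE {V : Type} (E : V → V → Prop) (X : V) (A : Set V) : V → V → Prop :=
  fun a b => (b = X ∧ a ∈ A) ∨ (b ≠ X ∧ E a b)

/-- The conditional intervention `do(X = g(A))` : replace the structural
assignment of `X` by the function that, given the values of the nodes in `A`,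
outputs `g` of those values, so that `A` becomes the parent set of `X`. -/
noncomputable def SCM.condIntervene {V : Type} {E : V → V → Prop} (scm : SCM V E)
    (X : V) (A : Set V) (g : (∀ a : A, scm.R a.1) → scm.R X) :
    SCM V (condE E X A) where
  R := scm.R
  rFin := scm.rFin
  rNe := scm.rNe
  N := scm.N
  nFin := scm.nFin
  nNe := scm.nNe
  f := fun v par nv =>
    if h : v = X then h.symm ▸ g (fun a => par ⟨a.1, Or.inl ⟨h, a.2⟩⟩)
    else scm.f v (fun p => par ⟨p.1, Or.inr ⟨h, p.2⟩⟩) nv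

/-! ## Interventional superiority -/

/-- `X` is (deterministically atomic-interventionally) superior to `W` relative
to `Y` : for every SCM over the graph in which the range of `Y` is linearly
ordered, and every unit `n`, there is `x ∈ R_X` such that for all `w ∈ R_W`,
`f̄_Y^{do(X=x)}(n) ≥ f̄_Y^{do(W=w)}(n)`. -/
def Superior {V : Type} [Fintype V] (E : V → V → Prop) (Y X W : V) : Prop :=
  ∀ (scm : SCM V E) (L : LinearOrder (scm.R Y)) (n : ∀ v, scm.N v),
    ∃ x : scm.R X, ∀ w : scm.R W,
      L.le (unroll (scm.intervene W w) n Y) (unroll (scm.intervene X x) n Y)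

/-- Superiority for sets of nodes: `S ≽_Y T` iff every node of `T` is inferior
to some node of `S`. -/
def SetSuperior {V : Type} [Fintype V] (E : V → V → Prop) (Y : V) (S T : Set V) : Prop :=
  ∀ W ∈ T, ∃ X ∈ S, Superior E Y X W

/-- A globally interventionally superior set (GISS) of the graph relative to
`Y` : a subset `U` of `V \ {Y}` with `U ≽_Y (V \ {Y}) \ U`. -/
def IsGISS {V : Type} [Fintype V] (E : V → V → Prop) (Y : V) (U : Set V) : Prop :=
  U ⊆ Set.univ \ {Y} ∧ SetSuperior E Y U ((Set.univ \ {Y}) \ U)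

/-- A minimal globally interventionally superior set (mGISS): a GISS that is
minimal with respect to set inclusion. -/
def IsMGISS {V : Type} [Fintype V] (E : V → V → Prop) (Y : V) (U : Set V) : Prop :=
  IsGISS E Y U ∧ ∀ U' : Set V, IsGISS E Y U' → U' ⊆ U → U' = U

section Walks

variable {V : Type} {E : V → V → Prop}

/-- A path all of whose nodes satisfy `P` gives reachability through nodes satisfying `P`. -/
lemma IsPath.reflTransGen {P : V → Prop} {p : List V} :
    ∀ {a b : V}, IsPath E a b p → (∀ w ∈ p, P w) →
      Relation.ReflTransGen (fun c d => E c d ∧ P c) a b := by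
  induction p with
  | nil => intro a b h; simp [IsPath] at h
  | cons x t ih =>
    rintro a b ⟨hc, hh, hl⟩ hP
    obtain rfl : x = a := by simpa using hh
    cases t with
    | nil =>
      obtain rfl : x = b := by simpa using hl
      exact .refl
    | cons y t =>
      have hc' := List.isChain_cons_cons.1 hc
      exact .head ⟨hc'.1, hP x (by simp)⟩
        (ih ⟨hc'.2, rfl, by simpa using hl⟩ fun w hw => hP w (List.mem_cons_of_mem _ hw))

/-- Reachability through nodes satisfying `P` is witnessed by a path all of whose nodes, except
possibly the last one, satisfy `P`. -/
lemma exists_isPath_of_reflTransGen {P : V → Prop} {a b : V}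
    (h : Relation.ReflTransGen (fun c d => E c d ∧ P c) a b) :
    ∃ p, IsPath E a b p ∧ ∀ w ∈ p, w = b ∨ P w := by
  induction h using Relation.ReflTransGen.head_induction_on with
  | refl => exact ⟨[b], ⟨List.isChain_singleton b, rfl, rfl⟩, by simp⟩
  | @head a c hac _ ih =>
    obtain ⟨p, ⟨hc, hh, hl⟩, hP⟩ := ih
    cases p with
    | nil => simp at hh
    | cons x t =>
      obtain rfl : x = c := by simpa using hh
      refine ⟨a :: x :: t, ⟨List.isChain_cons_cons.2 ⟨hac.1, hc⟩, rfl, by simpa using hl⟩, ?_⟩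
      intro w hw
      rcases List.mem_cons.1 hw with rfl | hw
      · exact .inr hac.2
      · exact hP w hw

/-- The nodes of `L` that can be reached from `v` by a path whose nodes, other than its endpoint,
lie outside `L`. -/
def exits (E : V → V → Prop) (L : Set V) (v : V) : Set V :=
  {z | z ∈ L ∧ Relation.ReflTransGen (fun c d => E c d ∧ c ∉ L) v z}

lemma reflTransGen_of_restrict {P : V → Prop} {a b : V}
    (h : Relation.ReflTransGen (fun c d => E c d ∧ P c) a b) : Relation.ReflTransGen E a b :=
  Relation.ReflTransGen.mono (fun _ _ h => h.1) _ _ h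

lemma exists_mem_exits {L : Set V} {P : V → Prop} {a b : V}
    (h : Relation.ReflTransGen (fun c d => E c d ∧ P c) a b) (hb : b ∈ L) (hPb : P b) :
    ∃ e ∈ exits E L a, P e ∧ Relation.ReflTransGen E e b := by
  induction h using Relation.ReflTransGen.head_induction_on with
  | refl => exact ⟨b, ⟨hb, .refl⟩, hPb, .refl⟩
  | @head a c hac hcb ih =>
    by_cases ha : a ∈ L
    · exact ⟨a, ⟨ha, .refl⟩, hac.2, .head hac.1 (reflTransGen_of_restrict hcb)⟩
    · obtain ⟨e, ⟨heL, he⟩, hPe, heb⟩ := ih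
      exact ⟨e, ⟨heL, .head ⟨hac.1, ha⟩ he⟩, hPe, heb⟩

/-- A path leading from `v` to `u` either passes through an exit of `v`, or stays outside `L`, in
which case the exits of `u` are exits of `v`. -/
lemma exits_cases {L : Set V} {v u : V} (h : Relation.ReflTransGen E v u) :
    (∃ e ∈ exits E L v, Relation.ReflTransGen E e u) ∨ (u ∉ L ∧ exits E L u ⊆ exits E L v) := by
  induction h using Relation.ReflTransGen.head_induction_on with
  | refl =>
    by_cases hu : u ∈ L
    · exact .inl ⟨u, ⟨hu, .refl⟩, .refl⟩
    · exact .inr ⟨hu, subset_rfl⟩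
  | @head a c hac hcu ih =>
    by_cases ha : a ∈ L
    · exact .inl ⟨a, ⟨ha, .refl⟩, .head hac hcu⟩
    · rcases ih with ⟨e, ⟨heL, he⟩, heu⟩ | ⟨hu, hsub⟩
      · exact .inl ⟨e, ⟨heL, .head ⟨hac, ha⟩ he⟩, heu⟩
      · exact .inr ⟨hu, fun z hz => ⟨(hsub hz).1, .head ⟨hac, ha⟩ (hsub hz).2⟩⟩

lemma mem_SCA_of_exits {L : Set V} {v z w : V} (hz : z ∈ exits E L v) (hw : w ∈ exits E L v)
    (hzw : z ≠ w) : v ∈ SCA E z w := by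
  obtain ⟨p, hp, hpL⟩ := exists_isPath_of_reflTransGen hz.2
  obtain ⟨q, hq, hqL⟩ := exists_isPath_of_reflTransGen hw.2
  exact ⟨⟨p, hp, fun h => (hpL w h).elim hzw.symm fun h => h hw.1⟩,
    ⟨q, hq, fun h => (hqL z h).elim hzw fun h => h hz.1⟩⟩

lemma reflTransGen_of_mem_SCA {x y u : V} (h : u ∈ SCA E x y) :
    Relation.ReflTransGen (fun c d => E c d ∧ c ≠ y) u x ∧
      Relation.ReflTransGen (fun c d => E c d ∧ c ≠ x) u y := by
  obtain ⟨⟨p, hp, hy⟩, ⟨q, hq, hx⟩⟩ := h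
  exact ⟨hp.reflTransGen fun w hw => ne_of_mem_of_not_mem hw hy,
    hq.reflTransGen fun w hw => ne_of_mem_of_not_mem hw hx⟩

lemma wellFounded_transGen [Finite V] (hacy : Acyclic E) : WellFounded (Relation.TransGen E) :=
  haveI : Std.Irrefl (Relation.TransGen E) := ⟨hacy⟩
  Finite.wellFounded_of_trans_of_irrefl _

lemma Acyclic.swap (hacy : Acyclic E) : Acyclic (Function.swap E) := fun v h =>
  hacy v (Relation.transGen_swap.1 h)

/-- If `L` contains every lowest strict common ancestor of any two of its elements, then a node
outside `L` has at most one exit into `L`. -/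
theorem exits_subsingleton [Finite V] (hacy : Acyclic E) {L : Set V}
    (hL : ∀ x ∈ L, ∀ y ∈ L, LSCApair E x y ⊆ L) {v : V} (hv : v ∉ L) :
    (exits E L v).Subsingleton := by
  induction v using (wellFounded_transGen hacy.swap).induction with
  | _ v ih =>
  by_contra hns
  rw [Set.not_subsingleton_iff] at hns
  obtain ⟨z, hz, hzmin⟩ := (wellFounded_transGen hacy).has_min _ hns.nonempty
  obtain ⟨w, hw, hwz⟩ := hns.exists_ne z
  refine hv (hL z hz.1 w hw.1 ⟨mem_SCA_of_exits hz hw hwz.symm, fun u hu huv hvu => ?_⟩)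
  obtain ⟨huz, huw⟩ := reflTransGen_of_mem_SCA hu
  have hne : u ≠ z := by
    rintro rfl
    rcases huw.cases_head with h | ⟨c, hc, _⟩
    · exact hwz h.symm
    · exact hc.2 rfl
  rcases exits_cases (L := L) hvu with ⟨e, he, heu⟩ | ⟨huL, hsub⟩
  · have huz' : Relation.TransGen E u z :=
      (Relation.reflTransGen_iff_eq_or_transGen.1 (reflTransGen_of_restrict huz)).resolve_left
        hne.symm
    exact hzmin e he (.trans_right heu huz')
  · have hvu' : Relation.TransGen E v u :=
      (Relation.reflTransGen_iff_eq_or_transGen.1 hvu).resolve_left huv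
    have hss := ih u (Relation.transGen_swap.2 hvu') huL
    obtain ⟨e, he, -, hez⟩ := exists_mem_exits huz hz.1 hwz.symm
    obtain ⟨e', he', hne', -⟩ := exists_mem_exits huw hw.1 hwz
    obtain rfl := hss he he'
    exact hzmin e (hsub he)
      ((Relation.reflTransGen_iff_eq_or_transGen.1 hez).resolve_left hne'.symm)

lemma lscaIter_mono (U : Set V) : Monotone (lscaIter E U) :=
  monotone_nat_of_le_succ fun _ => Set.subset_union_right

lemma subset_lscaClosure (U : Set V) : U ⊆ lscaClosure E U :=
  Set.subset_iUnion (lscaIter E U) 0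

lemma LSCApair_subset_lscaClosure {U : Set V} {x y : V} (hx : x ∈ lscaClosure E U)
    (hy : y ∈ lscaClosure E U) : LSCApair E x y ⊆ lscaClosure E U := by
  intro v hv
  obtain ⟨i, hi⟩ := Set.mem_iUnion.1 hx
  obtain ⟨j, hj⟩ := Set.mem_iUnion.1 hy
  refine Set.mem_iUnion.2 ⟨max i j + 1, ?_⟩
  by_cases h : v ∈ lscaIter E U (max i j)
  · exact .inr h
  · exact .inl ⟨h, x, lscaIter_mono U (le_max_left i j) hi, y,
      lscaIter_mono U (le_max_right i j) hj, hv⟩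

end Walks

/-- Let `G = (V, E)` be a finite DAG, `Y ∈ V`, let `B` be a
proper ancestor of `Y` with `B ∉ L∞(Pa(Y))`, and let `Z` be the (unique) node
of `L∞(Pa(Y))` reachable from `B` by a non-trivial path none of whose nodes
other than `Z` lies in `L∞(Pa(Y))`.  Then every path from `B` to `Y` contains
`Z`. -/
theorem all_paths_through_connector {V : Type} [Fintype V] (E : V → V → Prop)
    (hacy : Acyclic E) (Y B Z : V)
    (hBanc : B ∈ An E Y) (hBY : B ≠ Y)
    (hB : B ∉ lscaClosure E (Pa E Y))
    (hZ : Z ∈ lscaClosure E (Pa E Y))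
    (hZpath : ∃ p : List V, IsPath E B Z p ∧ 2 ≤ p.length ∧
      ∀ w ∈ p, w ≠ Z → w ∉ lscaClosure E (Pa E Y)) :
    ∀ p : List V, IsPath E B Y p → Z ∈ p := by
  intro p hp
  by_contra hZp
  obtain ⟨q, hq, -, hqL⟩ := hZpath
  have hZexit : ∃ e ∈ exits E (lscaClosure E (Pa E Y)) B, e = Z := by
    obtain ⟨e, he, heZ, -⟩ := exists_mem_exits
      (hq.reflTransGen (P := fun w => w ≠ Z → w ∉ lscaClosure E (Pa E Y)) hqL) hZ
      (absurd rfl)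
    exact ⟨e, he, by_contra fun h => heZ h he.1⟩
  obtain ⟨_, hZB, rfl⟩ := hZexit
  rcases (hp.reflTransGen fun w hw => ne_of_mem_of_not_mem hw hZp).cases_tail with
    h | ⟨c, hBc, hcY, hcZ⟩
  · exact hBY h.symm
  · obtain ⟨e, he, heZ, -⟩ := exists_mem_exits hBc (subset_lscaClosure (Pa E Y) hcY) hcZ
    exact heZ (exits_subsingleton hacy
      (fun _ hx _ hy => LSCApair_subset_lscaClosure hx hy) hB he hZB)
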